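/- arXiv:0712.1762 — 3 statements merged into one kernel-verified Lean document; each statement's English description precedes it below -/
import Mathlib

section
/- For integers n ≥ 1 and 1 ≤ k ≤ n, one has the q-binomial identity: ∑_{j=k}^n (1 - q^{n-2j}) · q^{j(j-n+1)} · [n choose j]_q² = (1 - p^k) · p^{-k(n-k+1)} · [n choose k]_p · [n-1 choose k-1]_p, where p = 1/q and [·choose·]_q denotes the Gaussian (q-)binomial coefficient. -/
open Finset

/-- The q-Pochhammer symbol `(a;q)_m`. -/
noncomputable def qPoch {K : Type*} [Field K] (q a : K) (m : ℕ) : K :=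
  ∏ i ∈ Finset.range m, (1 - a * q ^ i)

/-- The Gaussian (q-)binomial coefficient `[n choose k]_q`. -/
noncomputable def gbinom {K : Type*} [Field K] (q : K) (n k : ℕ) : K :=
  qPoch q q n / (qPoch q q k * qPoch q q (n - k))

theorem qPoch_succ {K : Type*} [Field K] (q : K) (m : ℕ) :
    qPoch q q (m + 1) = qPoch q q m * (1 - q ^ (m + 1)) := by
  rw [qPoch, prod_range_succ, ← pow_succ', qPoch]

theorem qPoch_ne_zero {K : Type*} [Field K] {q : K} (hq : ∀ m : ℕ, 1 ≤ m → q ^ m ≠ 1) (m : ℕ) :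
    qPoch q q m ≠ 0 := by
  refine prod_ne_zero_iff.mpr fun i _ => ?_
  rw [← pow_succ']
  exact sub_ne_zero.mpr (hq (i + 1) (by omega)).symm

theorem qPoch_inv {K : Type*} [Field K] {q : K} (hq0 : q ≠ 0) (m : ℕ) :
    qPoch q⁻¹ q⁻¹ m = (-1) ^ m * (∏ i ∈ range m, q ^ (i + 1))⁻¹ * qPoch q q m := by
  induction m with
  | zero => simp [qPoch]
  | succ m ih =>
    rw [qPoch_succ, qPoch_succ, ih, prod_range_succ, inv_pow]
    field_simp
    ring

theorem prod_range_pow_add {K : Type*} [Field K] (q : K) (k m : ℕ) :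
    ∏ i ∈ range (k + m), q ^ (i + 1) =
      (∏ i ∈ range k, q ^ (i + 1)) * (q ^ (k * m) * ∏ i ∈ range m, q ^ (i + 1)) := by
  rw [prod_range_add, pow_mul, ← card_range m, ← prod_const, card_range, ← prod_mul_distrib]
  congr 1
  exact prod_congr rfl fun i _ => by ring

theorem gbinom_inv {K : Type*} [Field K] {q : K} (hq0 : q ≠ 0)
    (hq : ∀ m : ℕ, 1 ≤ m → q ^ m ≠ 1) (k m : ℕ) :
    gbinom q⁻¹ (k + m) k = (q ^ (k * m))⁻¹ * gbinom q (k + m) k := by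
  have hprod (j : ℕ) : ∏ i ∈ range j, q ^ (i + 1) ≠ 0 :=
    prod_ne_zero_iff.mpr fun i _ => pow_ne_zero _ hq0
  have hk := hprod k
  have hm := hprod m
  have hk' := qPoch_ne_zero hq k
  have hm' := qPoch_ne_zero hq m
  simp only [gbinom, Nat.add_sub_cancel_left, qPoch_inv hq0]
  rw [prod_range_pow_add, pow_add (-1 : K)]
  field_simp

theorem gbinom_pred_pred {K : Type*} [Field K] {q : K}
    (hq : ∀ m : ℕ, 1 ≤ m → q ^ m ≠ 1) (k m : ℕ) :
    gbinom q (k + m) k =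
      gbinom q (k + 1 + m) (k + 1) * (1 - q ^ (k + 1)) / (1 - q ^ (k + 1 + m)) := by
  have hk := qPoch_ne_zero hq k
  have hm := qPoch_ne_zero hq m
  have h1 : 1 - q ^ (k + 1) ≠ 0 := sub_ne_zero.mpr (hq _ (by omega)).symm
  have h2 : 1 - q ^ (k + m + 1) ≠ 0 := sub_ne_zero.mpr (hq _ (by omega)).symm
  rw [show k + 1 + m = k + m + 1 by ring]
  simp only [gbinom, show k + m + 1 - (k + 1) = m by omega, Nat.add_sub_cancel_left, qPoch_succ]
  field_simp

theorem gbinom_succ_right {K : Type*} [Field K] {q : K}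
    (hq : ∀ m : ℕ, 1 ≤ m → q ^ m ≠ 1) (k m : ℕ) :
    gbinom q (k + m + 1) (k + 1) =
      gbinom q (k + m + 1) k * (1 - q ^ (m + 1)) / (1 - q ^ (k + 1)) := by
  have hk := qPoch_ne_zero hq k
  have hm := qPoch_ne_zero hq m
  have h1 : 1 - q ^ (k + 1) ≠ 0 := sub_ne_zero.mpr (hq _ (by omega)).symm
  have h2 : 1 - q ^ (m + 1) ≠ 0 := sub_ne_zero.mpr (hq _ (by omega)).symm
  simp only [gbinom, show k + m + 1 - (k + 1) = m by omega, show k + m + 1 - k = m + 1 by omega,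
    qPoch_succ q k, qPoch_succ q m]
  field_simp

theorem gbinom_self {K : Type*} [Field K] {q : K}
    (hq : ∀ m : ℕ, 1 ≤ m → q ^ m ≠ 1) (n : ℕ) : gbinom q n n = 1 := by
  have h0 : qPoch q q 0 = 1 := by simp [qPoch]
  simp [gbinom, h0, qPoch_ne_zero hq n]

theorem sum_Icc_gbinom_sq {K : Type*} [Field K] {q : K} (hq0 : q ≠ 0)
    (hq : ∀ m : ℕ, 1 ≤ m → q ^ m ≠ 1) {n k : ℕ} (hn : 1 ≤ n) (hkn : k ≤ n) :
    ∑ j ∈ Icc k n,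
        (1 - q ^ ((n : ℤ) - 2 * j)) * q ^ ((j : ℤ) * ((j : ℤ) - n + 1)) * (gbinom q n j) ^ 2
      = -(1 - q ^ k) ^ 2 / (1 - q ^ n) * q ^ (((k : ℤ) - 1) * ((k : ℤ) - n))
        * gbinom q n k ^ 2 := by
  have hn' : 1 - q ^ n ≠ 0 := sub_ne_zero.mpr (hq n hn).symm
  induction hkn using Nat.decreasingInduction with
  | self =>
    rw [Icc_self, sum_singleton, gbinom_self hq,
      show (n : ℤ) - 2 * n = -(n : ℤ) by ring, show (n : ℤ) * (n - n + 1) = n by ring,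
      sub_self, mul_zero, zpow_neg, zpow_natCast, zpow_zero]
    field_simp
    ring
  | of_succ k hk ih =>
    obtain ⟨m, rfl⟩ := Nat.exists_eq_add_of_lt hk
    have hk' : 1 - q ^ (k + 1) ≠ 0 := sub_ne_zero.mpr (hq _ (by omega)).symm
    rw [← Finset.insert_Icc_succ_left_eq_Icc hk.le, sum_insert (by simp), Order.succ_eq_add_one,
      ih, gbinom_succ_right hq]
    have e1 : (((k + 1 : ℕ) : ℤ) - 1) * (((k + 1 : ℕ) : ℤ) - ((k + m + 1 : ℕ) : ℤ)) = -(k * m : ℕ) := by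
      push_cast; ring
    have e2 : (k : ℤ) * ((k : ℤ) - ((k + m + 1 : ℕ) : ℤ) + 1) = -(k * m : ℕ) := by
      push_cast; ring
    have e3 : ((k : ℤ) - 1) * ((k : ℤ) - ((k + m + 1 : ℕ) : ℤ)) = -(k * m : ℕ) + (m + 1 : ℕ) - k := by
      push_cast; ring
    have e4 : ((k + m + 1 : ℕ) : ℤ) - 2 * k = (m + 1 : ℕ) - k := by push_cast; ring
    rw [e1, e2, e3, e4]
    simp only [zpow_sub₀ hq0, zpow_add₀ hq0, zpow_neg, zpow_natCast]
    field_simp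
    ring

/-- a finite very-well-poised q-binomial identity (a specialization of
Watson's transformation), with `p = q⁻¹`. -/
theorem stmt1 {K : Type*} [Field K] (q : K) (hq0 : q ≠ 0)
    (hq : ∀ m : ℕ, 1 ≤ m → q ^ m ≠ 1)
    (n k : ℕ) (hk : 1 ≤ k) (hkn : k ≤ n) :
    ∑ j ∈ Finset.Icc k n,
        (1 - q ^ ((n : ℤ) - 2 * j)) * q ^ ((j : ℤ) * ((j : ℤ) - n + 1)) * (gbinom q n j) ^ 2
      = (1 - q⁻¹ ^ (k : ℤ)) * q⁻¹ ^ (-(k : ℤ) * ((n : ℤ) - k + 1))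
        * gbinom q⁻¹ n k * gbinom q⁻¹ (n - 1) (k - 1) := by
  rw [sum_Icc_gbinom_sq hq0 hq (hk.trans hkn) hkn]
  obtain ⟨m, rfl⟩ := Nat.exists_eq_add_of_le hkn
  obtain ⟨k, rfl⟩ := Nat.exists_eq_add_of_le' hk
  have hn : 1 - q ^ (k + 1 + m) ≠ 0 := sub_ne_zero.mpr (hq _ (by omega)).symm
  rw [show k + 1 + m - 1 = k + m by omega, Nat.add_sub_cancel, gbinom_inv hq0 hq,
    gbinom_inv hq0 hq, gbinom_pred_pred hq k m]
  have e1 : (((k + 1 : ℕ) : ℤ) - 1) * (((k + 1 : ℕ) : ℤ) - ((k + 1 + m : ℕ) : ℤ))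
      = -(k * m : ℕ) := by
    push_cast; ring
  have e2 : -((k + 1 : ℕ) : ℤ) * (((k + 1 + m : ℕ) : ℤ) - ((k + 1 : ℕ) : ℤ) + 1)
      = -((k + 1) * m + (k + 1) : ℕ) := by
    push_cast; ring
  rw [e1, e2]
  simp only [zpow_neg, zpow_natCast, inv_pow, pow_add _ ((k + 1) * m)]
  field_simp
  ring
end

section
/- For integers n ≥ 1 and 1 ≤ k ≤ n: ∑_{j=k}^n (1 - q^{n-2j}) · q^{j² + j - nj - n(n+1)/2} · [n+j choose n]_q · [2n-j choose n]_q · [n choose j]_q² = (1 - p^k) · p^{k² - kn - k - n(n-1)/2} · ∑_{l=0}^{n-k} (-1)^l p^{l(2k+l-1)/2} · [n+k choose k+l]_p · [n-l-1 choose k-1]_p · [2n-k-l choose k, n-k, n-k-l]_p, where p = 1/q and the last factor is the q-multinomial coefficient (p;p)_{2n-k-l}/((p;p)_k (p;p)_{n-k} (p;p)_{n-k-l}). -/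
open Finset

/-- The q-multinomial coefficient `[a+b+c choose a,b,c]_q`. -/
noncomputable def qmultinom {K : Type*} [Field K] (q : K) (m a b c : ℕ) : K :=
  qPoch q q m / (qPoch q q a * qPoch q q b * qPoch q q c)

theorem qPoch_zero {K : Type*} [Field K] (q a : K) : qPoch q a 0 = 1 := by
  simp [qPoch]

theorem qPoch_self_succ {K : Type*} [Field K] (p : K) (m : ℕ) :
    qPoch p p (m + 1) = qPoch p p m * (1 - p ^ (m + 1)) := by
  rw [qPoch, Finset.prod_range_succ, ← qPoch, pow_succ']

theorem one_sub_pow_ne_zero {K : Type*} [Field K] {p : K} (hp : ∀ m : ℕ, 1 ≤ m → p ^ m ≠ 1)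
    (m : ℕ) : 1 - p ^ (m + 1) ≠ 0 :=
  sub_ne_zero.mpr (hp (m + 1) (by omega)).symm

theorem qPoch_self_ne_zero {K : Type*} [Field K] {p : K} (hp : ∀ m : ℕ, 1 ≤ m → p ^ m ≠ 1)
    (m : ℕ) : qPoch p p m ≠ 0 := by
  induction m with
  | zero => simp [qPoch_zero]
  | succ m ih =>
    rw [qPoch_self_succ]
    exact mul_ne_zero ih (one_sub_pow_ne_zero hp m)

theorem qPoch_inv_s3 {K : Type*} [Field K] {p : K} (hp0 : p ≠ 0) (m : ℕ) :
    qPoch p⁻¹ p⁻¹ m = (-1) ^ m / p ^ ((m + 1).choose 2) * qPoch p p m := by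
  induction m with
  | zero => simp [qPoch_zero]
  | succ m ih =>
    rw [qPoch_self_succ, qPoch_self_succ, ih, Nat.choose_succ_succ' (m + 1) 1, Nat.choose_one_right,
      pow_add p (m + 1), inv_pow]
    have := pow_ne_zero (m + 1) hp0
    generalize p ^ (m + 1) = x at *
    field_simp
    ring

theorem choose_two_add (a b : ℕ) :
    (a + b + 1).choose 2 = (a + 1).choose 2 + (b + 1).choose 2 + a * b := by
  induction b with
  | zero => simp
  | succ b ih =>
    rw [Nat.choose_succ_succ' (a + (b + 1)) 1, Nat.choose_succ_succ' (b + 1) 1,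
      Nat.choose_one_right, Nat.choose_one_right, ← add_assoc, ih]
    ring

theorem gbinom_inv_s3 {K : Type*} [Field K] {p : K} (hp0 : p ≠ 0) (m a b : ℕ) (h : m = a + b) :
    gbinom p⁻¹ m b = p ^ (-((a : ℤ) * b)) * gbinom p m b := by
  subst h
  simp only [gbinom, Nat.add_sub_cancel, qPoch_inv_s3 hp0, choose_two_add]
  have hz : p ^ (-((a : ℤ) * b)) = (p ^ (a * b))⁻¹ := by
    rw [zpow_neg, ← Nat.cast_mul, zpow_natCast]
  rw [hz, pow_add, pow_add, pow_add]
  have h1 := pow_ne_zero (a * b) hp0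
  have h2 := pow_ne_zero ((a + 1).choose 2) hp0
  have h3 := pow_ne_zero ((b + 1).choose 2) hp0
  have h4 : (-1 : K) ^ a ≠ 0 := pow_ne_zero a (by simp)
  have h5 : (-1 : K) ^ b ≠ 0 := pow_ne_zero b (by simp)
  field_simp

/-- The summand of index `l` of the transformed series for `k = a + 1` and `n = a + 1 + l + e`. -/
noncomputable def transformedTerm {K : Type*} [Field K] (p : K) (a l e : ℕ) : K :=
  (-1) ^ l * p ^ (l.choose 2) * (1 - p ^ (a + 1)) *
      (qPoch p p (2 * a + l + e + 2) * qPoch p p (a + e) * qPoch p p (a + l + 2 * e + 1)) /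
    (p ^ ((a + 1) * (e + 1)) *
      (qPoch p p (a + l + 1) * qPoch p p (a + e + 1) * qPoch p p a * qPoch p p e ^ 2 *
        qPoch p p (a + 1) * qPoch p p (l + e)))

/-- The telescoping partner of `transformedTerm`. -/
noncomputable def telescopingTerm {K : Type*} [Field K] (p : K) (a l e : ℕ) : K :=
  transformedTerm p a l e * (1 - p ^ (a + e + 1)) * (p ^ e - p ^ (a + 1)) /
    (p ^ e * (1 - p ^ (a + 1)) ^ 2)

theorem transformedTerm_sub {K : Type*} [Field K] {p : K} (hp0 : p ≠ 0)
    (hp : ∀ m : ℕ, 1 ≤ m → p ^ m ≠ 1) (a l e : ℕ) :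
    transformedTerm p a l (e + 1) - transformedTerm p (a + 1) l e =
      telescopingTerm p a l (e + 1) - telescopingTerm p a (l + 1) e := by
  have hP := qPoch_self_ne_zero hp
  have hs := one_sub_pow_ne_zero hp
  simp only [telescopingTerm, transformedTerm]
  rw [show 2 * a + l + (e + 1) + 2 = 2 * a + l + e + 3 by ring,
    show 2 * (a + 1) + l + e + 2 = 2 * a + l + e + 3 + 1 by ring,
    show 2 * a + (l + 1) + e + 2 = 2 * a + l + e + 3 by ring,
    show a + l + 2 * (e + 1) + 1 = a + l + 2 * e + 2 + 1 by ring,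
    show a + 1 + l + 2 * e + 1 = a + l + 2 * e + 2 by ring,
    show a + (l + 1) + 2 * e + 1 = a + l + 2 * e + 2 by ring,
    show a + (e + 1) = a + e + 1 by ring, show a + 1 + e = a + e + 1 by ring,
    show a + 1 + l = a + l + 1 by ring, show a + (l + 1) = a + l + 1 by ring,
    show l + (e + 1) = l + e + 1 by ring, show l + 1 + e = l + e + 1 by ring,
    show (a + 1) * (e + 1 + 1) = (a + 1) * (e + 1) + (a + 1) by ring,
    show (a + 1 + 1) * (e + 1) = (a + 1) * (e + 1) + (e + 1) by ring,
    Nat.choose_succ_succ' l 1, Nat.choose_one_right]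
  rw [qPoch_self_succ p (2 * a + l + e + 3), qPoch_self_succ p (a + l + 2 * e + 2),
    qPoch_self_succ p (a + e + 1), qPoch_self_succ p (a + e), qPoch_self_succ p (a + l + 1),
    qPoch_self_succ p (a + 1), qPoch_self_succ p a, qPoch_self_succ p e,
    qPoch_self_succ p (l + e)]
  have s1 := hs (a + l + 2 * e + 2)
  have s2 := hs (a + e + 1)
  have s3 := hs (a + e)
  have s4 := hs (a + l + 1)
  have s5 := hs (a + 1)
  have s6 := hs a
  have s7 := hs e
  have s8 := hs (l + e)
  have ha := pow_ne_zero a hp0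
  have he := pow_ne_zero e hp0
  have hae := pow_ne_zero ((a + 1) * (e + 1)) hp0
  have P1 := hP (a + e)
  have P2 := hP (a + l + 1)
  have P3 := hP a
  have P4 := hP e
  have P5 := hP (l + e)
  clear hP hs hp
  rw [pow_succ (-1 : K) l]
  generalize qPoch p p (2 * a + l + e + 3) = Q1 at *
  generalize qPoch p p (a + l + 2 * e + 2) = Q2 at *
  generalize qPoch p p (a + e) = Q3 at *
  generalize qPoch p p (a + l + 1) = Q4 at *
  generalize qPoch p p (l + e) = Q5 at *
  generalize qPoch p p a = Q6 at *
  generalize qPoch p p e = Q7 at *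
  generalize h1 : 1 - p ^ (a + l + 2 * e + 2 + 1) = c1 at *
  generalize h2 : 1 - p ^ (a + e + 1 + 1) = c2 at *
  generalize 1 - p ^ (a + e + 1) = c3 at *
  generalize h4 : 1 - p ^ (a + l + 1 + 1) = c4 at *
  generalize 1 - p ^ (a + 1 + 1) = c5 at *
  generalize h6 : 1 - p ^ (a + 1) = c6 at *
  generalize h7 : 1 - p ^ (e + 1) = c7 at *
  generalize h8 : 1 - p ^ (l + e + 1) = c8 at *
  simp only [pow_add p, pow_one, two_mul] at *
  generalize p ^ ((a + 1) * (e + 1)) = y at *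
  generalize p ^ l.choose 2 = t at *
  generalize p ^ a = u at *
  generalize p ^ e = v at *
  generalize p ^ l = w at *
  generalize (-1 : K) ^ l = ε at *
  field_simp
  rw [← h1, ← h2, ← h4, ← h6, ← h7, ← h8]
  ring

theorem sum_transformedTerm {K : Type*} [Field K] {p : K} (hp0 : p ≠ 0)
    (hp : ∀ m : ℕ, 1 ≤ m → p ^ m ≠ 1) (a d : ℕ) :
    ∑ l ∈ Finset.range (d + 1), transformedTerm p a l (d - l) =
      telescopingTerm p a 0 d +
        ∑ l ∈ Finset.range d, transformedTerm p (a + 1) l (d - 1 - l) := by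
  have hlast : transformedTerm p a d 0 = telescopingTerm p a d 0 := by
    have := one_sub_pow_ne_zero hp a
    rw [telescopingTerm, pow_zero, add_zero]
    field_simp
  have hstep : ∀ l ∈ Finset.range d,
      transformedTerm p a l (d - l) - transformedTerm p (a + 1) l (d - 1 - l) =
        telescopingTerm p a l (d - l) - telescopingTerm p a (l + 1) (d - (l + 1)) := by
    intro l hl
    obtain ⟨e, rfl⟩ := Nat.exists_eq_add_of_lt (Finset.mem_range.mp hl)
    rw [show l + e + 1 - l = e + 1 by omega, show l + e + 1 - 1 - l = e by omega,
      show l + e + 1 - (l + 1) = e by omega, transformedTerm_sub hp0 hp]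
  have hsum := Finset.sum_congr rfl hstep
  rw [Finset.sum_sub_distrib, Finset.sum_range_sub'
    (fun l => telescopingTerm p a l (d - l)) d] at hsum
  simp only [Nat.sub_self, Nat.sub_zero] at hsum
  rw [Finset.sum_range_succ, Nat.sub_self, hlast]
  linear_combination hsum

theorem wellPoised_summand_eq {K : Type*} [Field K] {p : K} (hp0 : p ≠ 0)
    (hp : ∀ m : ℕ, 1 ≤ m → p ^ m ≠ 1) (n a d : ℕ) (hn : n = a + 1 + d) :
    (1 - p⁻¹ ^ ((n : ℤ) - 2 * (a + 1 : ℕ))) *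
        p⁻¹ ^ (((a + 1 : ℕ) : ℤ) ^ 2 + (a + 1 : ℕ) - (n : ℤ) * (a + 1 : ℕ) -
          ((n * (n + 1) / 2 : ℕ) : ℤ)) *
        gbinom p⁻¹ (n + (a + 1)) n * gbinom p⁻¹ (2 * n - (a + 1)) n * gbinom p⁻¹ n (a + 1) ^ 2 =
      p ^ (-((n * (n - 1) / 2 : ℕ) : ℤ)) * telescopingTerm p a 0 d := by
  have hP := qPoch_self_ne_zero hp
  have s1 := one_sub_pow_ne_zero hp a
  have s2 := one_sub_pow_ne_zero hp (a + d)
  have hN : ((n * (n + 1) / 2 : ℕ) : ℤ) + ((n * (n - 1) / 2 : ℕ) : ℤ) = (n : ℤ) ^ 2 := by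
    obtain ⟨m, rfl⟩ : ∃ m, n = m + 1 := ⟨a + d, by omega⟩
    rw [Nat.add_sub_cancel, show (m + 1) * (m + 1 + 1) = (m + 1) * m + (m + 1) * 2 by ring,
      Nat.add_mul_div_right _ _ (by norm_num)]
    have : 2 ∣ (m + 1) * m := (mul_comm m (m + 1)) ▸ (Nat.even_mul_succ_self m).two_dvd
    obtain ⟨c, hc⟩ := this
    rw [hc, Nat.mul_div_cancel_left _ (by norm_num)]
    push_cast
    zify at hc
    linear_combination -hc
  rw [gbinom_inv_s3 hp0 (n + (a + 1)) (a + 1) n (by omega),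
    gbinom_inv_s3 hp0 (2 * n - (a + 1)) d n (by omega), gbinom_inv_s3 hp0 n d (a + 1) (by omega)]
  have hpow : p⁻¹ ^ (((a + 1 : ℕ) : ℤ) ^ 2 + (a + 1 : ℕ) - (n : ℤ) * (a + 1 : ℕ) -
          ((n * (n + 1) / 2 : ℕ) : ℤ)) * p ^ (-(((a + 1 : ℕ) : ℤ) * n)) *
        p ^ (-((d : ℤ) * n)) * p ^ (-((d : ℤ) * (a + 1 : ℕ))) * p ^ (-((d : ℤ) * (a + 1 : ℕ))) =
      p ^ (-((n * (n - 1) / 2 : ℕ) : ℤ)) * (p ^ ((a + 1) * (d + 1)))⁻¹ := by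
    rw [← zpow_natCast p, ← zpow_neg, inv_zpow', ← zpow_add₀ hp0, ← zpow_add₀ hp0,
      ← zpow_add₀ hp0, ← zpow_add₀ hp0, ← zpow_add₀ hp0]
    congr 1
    subst hn
    push_cast at hN ⊢
    linear_combination hN
  have hlin : 1 - p⁻¹ ^ ((n : ℤ) - 2 * (a + 1 : ℕ)) = (p ^ d - p ^ (a + 1)) / p ^ d := by
    rw [sub_div, div_self (pow_ne_zero d hp0), inv_zpow', ← zpow_natCast p (a + 1),
      ← zpow_natCast p d, ← zpow_sub₀ hp0]
    congr 2
    subst hn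
    push_cast
    ring
  have hbin : gbinom p (n + (a + 1)) n * gbinom p (2 * n - (a + 1)) n * gbinom p n (a + 1) ^ 2 *
        (p ^ d - p ^ (a + 1)) / p ^ d * (p ^ ((a + 1) * (d + 1)))⁻¹ =
      telescopingTerm p a 0 d := by
    simp only [telescopingTerm, transformedTerm, gbinom]
    rw [show n + (a + 1) - n = a + 1 by omega, show 2 * n - (a + 1) - n = d by omega,
      show n - (a + 1) = d by omega, show n + (a + 1) = 2 * a + 0 + d + 2 by omega,
      show 2 * n - (a + 1) = a + 0 + 2 * d + 1 by omega, show n = a + d + 1 by omega, add_zero,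
      zero_add, qPoch_self_succ p (a + d), qPoch_self_succ p a]
    have := hP (a + d)
    have := hP a
    have := hP d
    have := pow_ne_zero d hp0
    have := pow_ne_zero ((a + 1) * (d + 1)) hp0
    simp only [Nat.choose_zero_succ, pow_zero, one_mul]
    field_simp
  rw [hlin]
  linear_combination (p ^ d - p ^ (a + 1)) / p ^ d * gbinom p (n + (a + 1)) n *
    gbinom p (2 * n - (a + 1)) n * gbinom p n (a + 1) ^ 2 * hpow +
    p ^ (-((n * (n - 1) / 2 : ℕ) : ℤ)) * hbin

theorem transformed_summand_eq {K : Type*} [Field K] {p : K} (hp0 : p ≠ 0)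
    (n a l e : ℕ) (hn : n = a + 1 + l + e) :
    (1 - p ^ ((a + 1 : ℕ) : ℤ)) *
        p ^ (((a + 1 : ℕ) : ℤ) ^ 2 - ((a + 1 : ℕ) : ℤ) * n - ((a + 1 : ℕ) : ℤ) -
          ((n * (n - 1) / 2 : ℕ) : ℤ)) *
        ((-1 : K) ^ l * p ^ (l * (2 * (a + 1) + l - 1) / 2) *
          gbinom p (n + (a + 1)) (a + 1 + l) * gbinom p (n - l - 1) (a + 1 - 1) *
          qmultinom p (2 * n - (a + 1) - l) (a + 1) (n - (a + 1)) (n - (a + 1) - l)) =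
      p ^ (-((n * (n - 1) / 2 : ℕ) : ℤ)) * transformedTerm p a l e := by
  have hexp : l * (2 * (a + 1) + l - 1) / 2 = (a + 1) * l + l.choose 2 := by
    rw [Nat.choose_two_right]
    rcases l with _ | m
    · simp
    · rw [show (m + 1) * (2 * (a + 1) + (m + 1) - 1) = (m + 1) * (m + 1 - 1) + (a + 1) * (m + 1) * 2
        by rw [Nat.add_sub_cancel, show 2 * (a + 1) + (m + 1) - 1 = 2 * (a + 1) + m by omega]; ring,
        Nat.add_mul_div_right _ _ (by norm_num), add_comm]
  have hpow : p ^ (((a + 1 : ℕ) : ℤ) ^ 2 - ((a + 1 : ℕ) : ℤ) * n - ((a + 1 : ℕ) : ℤ) -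
        ((n * (n - 1) / 2 : ℕ) : ℤ)) * p ^ ((a + 1) * l) =
      p ^ (-((n * (n - 1) / 2 : ℕ) : ℤ)) * (p ^ ((a + 1) * (e + 1)))⁻¹ := by
    rw [← zpow_natCast p ((a + 1) * l), ← zpow_natCast p ((a + 1) * (e + 1)), ← zpow_neg,
      ← zpow_add₀ hp0, ← zpow_add₀ hp0]
    congr 1
    subst hn
    push_cast
    ring
  have hrest : (1 - p ^ ((a + 1 : ℕ) : ℤ)) * ((-1 : K) ^ l * p ^ (l.choose 2) *
        gbinom p (n + (a + 1)) (a + 1 + l) * gbinom p (n - l - 1) (a + 1 - 1) *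
        qmultinom p (2 * n - (a + 1) - l) (a + 1) (n - (a + 1)) (n - (a + 1) - l)) *
        (p ^ ((a + 1) * (e + 1)))⁻¹ = transformedTerm p a l e := by
    simp only [transformedTerm, gbinom, qmultinom, zpow_natCast]
    rw [show n + (a + 1) - (a + 1 + l) = a + e + 1 by omega,
      show n + (a + 1) = 2 * a + l + e + 2 by omega, show a + 1 + l = a + l + 1 by omega,
      show n - l - 1 - (a + 1 - 1) = e by omega, show n - l - 1 = a + e by omega,
      show 2 * n - (a + 1) - l = a + l + 2 * e + 1 by omega, show n - (a + 1) - l = e by omega,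
      show n - (a + 1) = l + e by omega, show a + 1 - 1 = a by omega]
    simp only [div_eq_mul_inv, mul_inv]
    ring
  rw [hexp, pow_add, ← hrest]
  linear_combination (1 - p ^ ((a + 1 : ℕ) : ℤ)) * ((-1 : K) ^ l * p ^ (l.choose 2) *
        gbinom p (n + (a + 1)) (a + 1 + l) * gbinom p (n - l - 1) (a + 1 - 1) *
        qmultinom p (2 * n - (a + 1) - l) (a + 1) (n - (a + 1)) (n - (a + 1) - l)) * hpow

theorem sum_telescopingTerm {K : Type*} [Field K] {p : K} (hp0 : p ≠ 0)
    (hp : ∀ m : ℕ, 1 ≤ m → p ^ m ≠ 1) (a d : ℕ) :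
    ∑ i ∈ Finset.range (d + 1), telescopingTerm p (a + i) 0 (d - i) =
      ∑ l ∈ Finset.range (d + 1), transformedTerm p a l (d - l) := by
  induction d generalizing a with
  | zero => simpa using (sum_transformedTerm hp0 hp a 0).symm
  | succ d ih =>
    rw [sum_transformedTerm hp0 hp a (d + 1), Finset.sum_range_succ', Nat.add_sub_cancel, ← ih,
      add_comm]
    congr 1
    refine Finset.sum_congr rfl fun i _ => ?_
    rw [Nat.add_sub_add_right, add_right_comm, add_assoc]

/-- a finite very-well-poised q-hypergeometric transformation
(single sum into a multiple/simple sum in `p = q⁻¹`). -/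
theorem stmt3 {K : Type*} [Field K] (q : K) (hq0 : q ≠ 0)
    (hq : ∀ m : ℕ, 1 ≤ m → q ^ m ≠ 1)
    (n k : ℕ) (hk : 1 ≤ k) (hkn : k ≤ n) :
    ∑ j ∈ Finset.Icc k n,
        (1 - q ^ ((n : ℤ) - 2 * j)) *
          q ^ ((j : ℤ) ^ 2 + j - (n : ℤ) * j - ((n * (n + 1) / 2 : ℕ) : ℤ)) *
          gbinom q (n + j) n * gbinom q (2 * n - j) n * (gbinom q n j) ^ 2
      = (1 - q⁻¹ ^ (k : ℤ)) *
          q⁻¹ ^ ((k : ℤ) ^ 2 - (k : ℤ) * n - (k : ℤ) - ((n * (n - 1) / 2 : ℕ) : ℤ)) *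
          ∑ l ∈ Finset.range (n - k + 1),
            (-1 : K) ^ l * q⁻¹ ^ (l * (2 * k + l - 1) / 2) *
              gbinom q⁻¹ (n + k) (k + l) * gbinom q⁻¹ (n - l - 1) (k - 1) *
              qmultinom q⁻¹ (2 * n - k - l) k (n - k) (n - k - l) := by
  obtain ⟨p, rfl⟩ : ∃ p, q = p⁻¹ := ⟨q⁻¹, (inv_inv q).symm⟩
  have hp0 : p ≠ 0 := fun h => hq0 (by simp [h])
  have hp : ∀ m : ℕ, 1 ≤ m → p ^ m ≠ 1 := fun m hm h => hq m hm (by simp [h])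
  obtain ⟨a, rfl⟩ : ∃ a, k = a + 1 := ⟨k - 1, by omega⟩
  obtain ⟨d, hn⟩ := Nat.exists_eq_add_of_le hkn
  rw [inv_inv, Finset.mul_sum, ← Finset.Ico_add_one_right_eq_Icc, Finset.sum_Ico_eq_sum_range,
    show n + 1 - (a + 1) = d + 1 by omega, show n - (a + 1) + 1 = d + 1 by omega]
  trans p ^ (-((n * (n - 1) / 2 : ℕ) : ℤ)) *
    ∑ i ∈ Finset.range (d + 1), telescopingTerm p (a + i) 0 (d - i)
  · rw [Finset.mul_sum]
    refine Finset.sum_congr rfl fun i hi => ?_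
    have := Finset.mem_range.mp hi
    rw [show a + 1 + i = a + i + 1 by ring]
    exact wellPoised_summand_eq hp0 hp n (a + i) (d - i) (by omega)
  · rw [sum_telescopingTerm hp0 hp, Finset.mul_sum]
    refine Finset.sum_congr rfl fun l hl => ?_
    have := Finset.mem_range.mp hl
    exact (transformed_summand_eq hp0 n a l (d - l) (by omega)).symm
end

section
/- Let A ≥ 4 be an even integer, r ≥ 1 an integer with A > 2r, and q real with 0 < |q| < 1. Define ρ_k(q) = q^k(1−q^{2k+n})·R̃_n(q^k;q) where R̃_n(T;q) = T^{(A−2r)n/2+A/2−2} q^{−An(n+1)/2} (q;q)_n^{A−2r} (q^{−rn}T;q)_{rn} (q^{n+1}T;q)_{rn} / ∏_{i=0}^n (T−q^{−i})^A, and S̃_n(q) = ∑_{k≥1} ρ_k(q). Then ρ_k(q) = 0 for 1 ≤ k ≤ rn, and lim_{n→∞} (1/n²) log|S̃_n(q)| = −(r(A−2r)/2)·log|1/q|. -/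
open Filter

/-- The rational function `R̃_n(T;q)`. -/
noncomputable def Rt (q : ℝ) (A r n : ℕ) (T : ℝ) : ℝ :=
  T ^ ((A - 2 * r) * n / 2 + A / 2 - 2) * q ^ (-(((A : ℤ) * n * (n + 1)) / 2)) *
    (∏ i ∈ Finset.range n, (1 - q ^ (i + 1))) ^ (A - 2 * r) *
    (∏ i ∈ Finset.range (r * n), (1 - q ^ (-(r * n : ℤ) + i) * T)) *
    (∏ i ∈ Finset.range (r * n), (1 - q ^ (n + 1 + i) * T)) /
    ∏ i ∈ Finset.range (n + 1), (T - q ^ (-(i : ℤ))) ^ A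

/-- `ρ_k(q) = q^k (1 − q^{2k+n}) R̃_n(q^k; q)`. -/
noncomputable def rho (q : ℝ) (A r n k : ℕ) : ℝ :=
  q ^ k * (1 - q ^ (2 * k + n)) * Rt q A r n (q ^ k)

/-- `S̃_n(q) = ∑_{k ≥ 1} ρ_k(q)`. -/
noncomputable def St (q : ℝ) (A r n : ℕ) : ℝ :=
  ∑' k : ℕ, rho q A r n (k + 1)

/-- `x` is nonzero and its logarithm is at most `K` in absolute value. -/
def LogBounded (K x : ℝ) : Prop := x ≠ 0 ∧ |Real.log x| ≤ K

namespace LogBounded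

theorem mul {K L x y : ℝ} (hx : LogBounded K x) (hy : LogBounded L y) :
    LogBounded (K + L) (x * y) := by
  refine ⟨mul_ne_zero hx.1 hy.1, ?_⟩
  rw [Real.log_mul hx.1 hy.1]
  exact (abs_add_le _ _).trans (add_le_add hx.2 hy.2)

theorem inv {K x : ℝ} (hx : LogBounded K x) : LogBounded K x⁻¹ := by
  refine ⟨inv_ne_zero hx.1, ?_⟩
  rw [Real.log_inv, abs_neg]
  exact hx.2

theorem pow {K x : ℝ} (hx : LogBounded K x) (m : ℕ) : LogBounded (m * K) (x ^ m) := by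
  refine ⟨pow_ne_zero m hx.1, ?_⟩
  rw [Real.log_pow, abs_mul, Nat.abs_cast]
  exact mul_le_mul_of_nonneg_left hx.2 (Nat.cast_nonneg m)

theorem abs_le_exp {K x : ℝ} (hx : LogBounded K x) : |x| ≤ Real.exp K := by
  rw [← Real.exp_log (abs_pos.2 hx.1), Real.log_abs]
  exact Real.exp_le_exp.2 (abs_le.1 hx.2).2

theorem exp_neg_le_abs {K x : ℝ} (hx : LogBounded K x) : Real.exp (-K) ≤ |x| := by
  rw [← Real.exp_log (abs_pos.2 hx.1), Real.log_abs]
  exact Real.exp_le_exp.2 (abs_le.1 hx.2).1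

end LogBounded

theorem logBounded_one_sub {t x : ℝ} (ht : t < 1) (hx : |x| ≤ t) :
    LogBounded (|x| / (1 - t)) (1 - x) := by
  have h1 : 0 < 1 - t := by linarith
  have hx0 := abs_nonneg x
  obtain ⟨hxl, hxu⟩ := abs_le.1 hx
  have hpos : 0 < 1 - x := by linarith
  refine ⟨hpos.ne', abs_le.2 ⟨?_, ?_⟩⟩
  · have h := Real.log_le_sub_one_of_pos (inv_pos.2 hpos)
    rw [Real.log_inv] at h
    have h2 : (1 - x)⁻¹ - 1 = x / (1 - x) := by field_simp; ring
    have h3 : x / (1 - x) ≤ |x| / (1 - t) :=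
      div_le_div₀ hx0 (le_abs_self x) h1 (by linarith)
    linarith
  · have h := Real.log_le_sub_one_of_pos hpos
    have h2 : |x| ≤ |x| / (1 - t) := by
      rw [le_div_iff₀ h1]
      nlinarith
    linarith [neg_abs_le x]

/-- Finite products of factors `1 - q ^ j` over consecutive `j ≥ 1` are bounded away from `0` and
`∞`, uniformly in the range of `j`. -/
theorem logBounded_prod_one_sub_pow {q : ℝ} (hq : |q| < 1) (e m : ℕ) :
    LogBounded (1 / (1 - |q|) ^ 2) (∏ i ∈ Finset.range m, (1 - q ^ (e + 1 + i))) := by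
  have h1 : 0 < 1 - |q| := by linarith
  have hle : ∀ i, |q ^ (e + 1 + i)| ≤ |q| ^ i ∧ |q ^ (e + 1 + i)| ≤ |q| := by
    intro i
    rw [abs_pow]
    exact ⟨pow_le_pow_of_le_one (abs_nonneg q) hq.le (by lia),
      pow_le_of_le_one (abs_nonneg q) hq.le (by lia)⟩
  have hf := fun i => logBounded_one_sub hq (hle i).2
  refine ⟨Finset.prod_ne_zero_iff.2 fun i _ => (hf i).1, ?_⟩
  rw [Real.log_prod fun i _ => (hf i).1]
  calc |∑ i ∈ Finset.range m, Real.log (1 - q ^ (e + 1 + i))|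
      ≤ ∑ i ∈ Finset.range m, |Real.log (1 - q ^ (e + 1 + i))| := Finset.abs_sum_le_sum_abs _ _
    _ ≤ ∑ i ∈ Finset.range m, |q| ^ i / (1 - |q|) := by
        refine Finset.sum_le_sum fun i _ => (hf i).2.trans ?_
        exact div_le_div_of_nonneg_right (hle i).1 h1.le
    _ = (∑ i ∈ Finset.range m, |q| ^ i) / (1 - |q|) := by rw [Finset.sum_div]
    _ ≤ (1 - |q|)⁻¹ / (1 - |q|) := by
        refine div_le_div_of_nonneg_right ?_ h1.le
        rw [← tsum_geometric_of_lt_one (abs_nonneg q) hq]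
        exact (summable_geometric_of_lt_one (abs_nonneg q) hq).sum_le_tsum _
          fun i _ => pow_nonneg (abs_nonneg q) i
    _ = 1 / (1 - |q|) ^ 2 := by field_simp

/-- A series dominated by a rapidly decaying geometric series has the size of its first term. -/
theorem abs_log_abs_tsum_sub_log_le {u : ℕ → ℝ} {K P x : ℝ} (hK : 0 ≤ K) (hP : 0 < P)
    (hx0 : 0 ≤ x) (hx : x ≤ Real.exp (-(2 * K)) / 4)
    (hu : ∀ j, |u j| ≤ Real.exp K * P * x ^ j) (hu0 : Real.exp (-K) * P ≤ |u 0|) :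
    |Real.log |∑' j, u j| - Real.log P| ≤ K + Real.log 2 := by
  have hE : Real.exp (-(2 * K)) ≤ 1 := Real.exp_le_one_iff.2 (by linarith)
  have hx1 : x < 1 := by linarith
  have hgeo := (summable_geometric_of_lt_one hx0 hx1).mul_left (Real.exp K * P)
  have hsum : Summable u := Summable.of_norm_bounded hgeo hu
  have htail : |∑' j, u (j + 1)| ≤ Real.exp K * P * x * (1 - x)⁻¹ := by
    have hg : HasSum (fun j : ℕ => Real.exp K * P * x * x ^ j)
        (Real.exp K * P * x * (1 - x)⁻¹) :=
      (hasSum_geometric_of_lt_one hx0 hx1).mul_left _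
    rw [← Real.norm_eq_abs]
    refine tsum_of_norm_bounded hg fun j => ?_
    rw [Real.norm_eq_abs, mul_assoc _ x, ← pow_succ']
    exact hu (j + 1)
  have hbound : Real.exp K * P * x * (1 - x)⁻¹ ≤ Real.exp (-K) * P / 2 := by
    rw [← div_eq_mul_inv, div_le_iff₀ (by linarith)]
    have hexp : Real.exp K * Real.exp (-(2 * K)) = Real.exp (-K) := by
      rw [← Real.exp_add]; ring_nf
    have hKP : 0 < Real.exp K * P := by positivity
    have h1 : Real.exp K * P * x ≤ Real.exp (-K) * P / 4 := by
      calc Real.exp K * P * x ≤ Real.exp K * P * (Real.exp (-(2 * K)) / 4) := by gcongr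
        _ = Real.exp K * Real.exp (-(2 * K)) * P / 4 := by ring
        _ = _ := by rw [hexp]
    have h2 : 0 < Real.exp (-K) * P := by positivity
    nlinarith
  have hKle : Real.exp (-K) ≤ Real.exp K := Real.exp_le_exp.2 (by linarith)
  have hKP := mul_le_mul_of_nonneg_right hKle hP.le
  have hKP0 : 0 < Real.exp (-K) * P := by positivity
  have hu0' := hu 0
  rw [pow_zero, mul_one] at hu0'
  have hlow : Real.exp (-K) * P / 2 ≤ |∑' j, u j| := by
    rw [hsum.tsum_eq_zero_add]
    have := abs_sub_abs_le_abs_sub (u 0) (-∑' j, u (j + 1))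
    rw [abs_neg, sub_neg_eq_add] at this
    linarith
  have hupp : |∑' j, u j| ≤ Real.exp K * P * 2 := by
    rw [hsum.tsum_eq_zero_add]
    have := abs_add_le (u 0) (∑' j, u (j + 1))
    linarith
  have hl := Real.log_le_log (by positivity) hlow
  have hr := Real.log_le_log (lt_of_lt_of_le (by positivity) hlow) hupp
  rw [Real.log_div (by positivity) two_ne_zero, Real.log_mul (by positivity) hP.ne',
    Real.log_exp] at hl
  rw [Real.log_mul (by positivity) two_ne_zero, Real.log_mul (by positivity) hP.ne',
    Real.log_exp] at hr
  exact abs_le.2 ⟨by linarith, by linarith⟩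

theorem rho_eq_zero {q : ℝ} (hq0 : q ≠ 0) (A : ℕ) {r n k : ℕ} (hk : 1 ≤ k) (hkn : k ≤ r * n) :
    rho q A r n k = 0 := by
  have h : ∏ i ∈ Finset.range (r * n), (1 - q ^ (-(r * n : ℤ) + i) * q ^ k) = 0 := by
    refine Finset.prod_eq_zero (i := r * n - k) (Finset.mem_range.2 (by lia)) ?_
    rw [← zpow_natCast q k, ← zpow_add₀ hq0]
    push_cast [hkn]
    ring_nf
    simp
  simp [rho, Rt, h]

theorem prod_pow_sub_zpow_neg_pow {q : ℝ} (hq0 : q ≠ 0) (a n k : ℕ) :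
    ∏ i ∈ Finset.range (n + 1), (q ^ k - q ^ (-(i : ℤ))) ^ (2 * a) =
      q ^ (-((((2 * a : ℕ) : ℤ) * n * (n + 1)) / 2)) *
        (∏ i ∈ Finset.range (n + 1), (1 - q ^ (k + i))) ^ (2 * a) := by
  have hdiv : ∀ n : ℕ, (((2 * a : ℕ) : ℤ) * n * (n + 1)) / 2 = (a : ℤ) * n * (n + 1) := by
    intro n
    push_cast
    rw [mul_assoc, mul_assoc, Int.mul_ediv_cancel_left _ two_ne_zero]
    ring
  rw [hdiv]
  induction n with
  | zero =>
    simp only [zero_add, Finset.prod_range_one, Nat.cast_zero, neg_zero, zpow_zero, add_zero,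
      mul_zero, zero_mul, one_mul]
    rw [← neg_sub, (even_two_mul a).neg_pow]
  | succ n ih =>
    rw [Finset.prod_range_succ, ih, Finset.prod_range_succ _ (n + 1)]
    have h1 : q ^ k - q ^ (-((n + 1 : ℕ) : ℤ)) =
        -(q ^ (-((n + 1 : ℕ) : ℤ)) * (1 - q ^ (k + (n + 1)))) := by
      rw [mul_sub, ← zpow_natCast q (k + (n + 1)), ← zpow_add₀ hq0, ← zpow_natCast q k]
      push_cast
      ring_nf
    have h2 : (q ^ (-((n + 1 : ℕ) : ℤ))) ^ (2 * a) * q ^ (-((a : ℤ) * n * (n + 1))) =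
        q ^ (-((a : ℤ) * (n + 1 : ℕ) * ((n + 1 : ℕ) + 1))) := by
      rw [← zpow_natCast, ← zpow_mul, ← zpow_add₀ hq0]
      congr 1
      push_cast
      ring
    rw [h1, (even_two_mul a).neg_pow, mul_pow, mul_pow, ← h2]
    ring

/-- Past its zeros, `ρ_k` is a power of `q` times a factor bounded away from `0` and `∞`. -/
theorem exists_logBounded_rho_eq {q : ℝ} (hq0 : q ≠ 0) (hq1 : |q| < 1) {a : ℕ} (ha : 2 ≤ a)
    (r n j : ℕ) :
    ∃ w : ℝ, LogBounded ((4 * a + 3) * (1 / (1 - |q|) ^ 2)) w ∧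
      rho q (2 * a) r n (r * n + 1 + j) =
        q ^ ((r * n + 1 + j) * ((a - r) * n + a - 1)) * w := by
  set K := 1 / (1 - |q|) ^ 2
  set k := r * n + 1 + j with hk
  set D := ∏ i ∈ Finset.range (n + 1), (1 - q ^ (k + i)) with hD
  set Q := ∏ i ∈ Finset.range n, (1 - q ^ (i + 1)) with hQ
  set F := ∏ i ∈ Finset.range (r * n), (1 - q ^ (j + 1 + i)) with hF
  set G := ∏ i ∈ Finset.range (r * n), (1 - q ^ (n + k + 1 + i)) with hG
  have bK : 0 ≤ K := by positivity
  have b1 : LogBounded K (1 - q ^ (2 * k + n)) := by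
    have h := logBounded_prod_one_sub_pow hq1 (2 * k + n - 1) 1
    rwa [Finset.prod_range_one, add_zero, Nat.sub_add_cancel (by lia)] at h
  have bQ : LogBounded K Q := by
    have h := logBounded_prod_one_sub_pow hq1 0 n
    simp only [zero_add, add_comm 1] at h
    exact h
  have bF : LogBounded K F := logBounded_prod_one_sub_pow hq1 j (r * n)
  have bG : LogBounded K G := logBounded_prod_one_sub_pow hq1 (n + k) (r * n)
  have bD : LogBounded K D := by
    have h := logBounded_prod_one_sub_pow hq1 (r * n + j) (n + 1)
    rwa [show r * n + j + 1 = k by lia] at h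
  have hA : 2 * a - 2 * r = 2 * (a - r) := by lia
  refine ⟨(1 - q ^ (2 * k + n)) * Q ^ (2 * a - 2 * r) * F * G * (D ^ (2 * a))⁻¹, ?_, ?_⟩
  · have h := (((b1.mul (bQ.pow (2 * a - 2 * r))).mul bF).mul bG).mul (bD.pow (2 * a)).inv
    refine ⟨h.1, h.2.trans ?_⟩
    have h2 : ((2 * a - 2 * r : ℕ) : ℝ) ≤ 2 * a := by
      exact_mod_cast (Nat.sub_le _ _)
    have h3 := mul_le_mul_of_nonneg_right h2 bK
    push_cast
    linarith
  · have hF' : ∏ i ∈ Finset.range (r * n), (1 - q ^ (-(r * n : ℤ) + i) * q ^ k) = F := by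
      refine Finset.prod_congr rfl fun i _ => ?_
      rw [← zpow_natCast q k, ← zpow_add₀ hq0, ← zpow_natCast q (j + 1 + i), hk]
      push_cast
      ring_nf
    have hG' : ∏ i ∈ Finset.range (r * n), (1 - q ^ (n + 1 + i) * q ^ k) = G := by
      refine Finset.prod_congr rfl fun i _ => ?_
      rw [← pow_add]
      ring_nf
    have hpow : q ^ k * (q ^ k) ^ ((2 * a - 2 * r) * n / 2 + 2 * a / 2 - 2) =
        q ^ (k * ((a - r) * n + a - 1)) := by
      rw [hA, mul_assoc, Nat.mul_div_cancel_left _ two_pos, Nat.mul_div_cancel_left _ two_pos,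
        ← pow_succ', ← pow_mul]
      congr 2
      lia
    have hz : q ^ (-((((2 * a : ℕ) : ℤ) * n * (n + 1)) / 2)) ≠ 0 := zpow_ne_zero _ hq0
    rw [rho, Rt, hF', hG', prod_pow_sub_zpow_neg_pow hq0, ← hD, ← hQ, ← hpow]
    have hD0 := bD.1
    generalize q ^ (-((((2 * a : ℕ) : ℤ) * n * (n + 1)) / 2)) = z at hz ⊢
    field_simp

theorem abs_log_abs_St_sub_le {q : ℝ} (hq0 : q ≠ 0) (hq1 : |q| < 1) {a r : ℕ} (hr : r < a)
    (ha : 2 ≤ a) : ∃ C : ℝ, ∀ᶠ n : ℕ in atTop, |Real.log (|St q (2 * a) r n|) -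
      ((r * n + 1) * ((a - r) * n + a - 1) : ℝ) * Real.log (|q|)| ≤ C := by
  set K := (4 * a + 3) * (1 / (1 - |q|) ^ 2) with hKdef
  have hK : 0 ≤ K := by positivity
  have hq : 0 < |q| := abs_pos.2 hq0
  refine ⟨K + Real.log 2, ?_⟩
  have hsmall : ∀ᶠ n : ℕ in atTop, |q| ^ n ≤ Real.exp (-(2 * K)) / 4 :=
    (tendsto_pow_atTop_nhds_zero_of_lt_one hq.le hq1).eventually_le_const (by positivity)
  filter_upwards [hsmall] with n hn
  set N := (a - r) * n + a - 1 with hN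
  have hnN : n ≤ N := by
    have : 1 * n ≤ (a - r) * n := Nat.mul_le_mul_right n (by lia)
    lia
  have hNcast : (N : ℝ) = (a - r) * n + a - 1 := by
    rw [hN, Nat.cast_sub (by lia)]
    push_cast [hr.le]
    ring
  have hsize : ∀ j, ∃ w, LogBounded K w ∧
      |rho q (2 * a) r n (r * n + 1 + j)| = |w| * |q| ^ ((r * n + 1) * N) * (|q| ^ N) ^ j := by
    intro j
    obtain ⟨w, hw, he⟩ := exists_logBounded_rho_eq hq0 hq1 ha r n j
    refine ⟨w, hw, ?_⟩
    rw [he, abs_mul, abs_pow, ← hN]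
    ring
  have hP : 0 < |q| ^ ((r * n + 1) * N) := by positivity
  have hu : ∀ j, |rho q (2 * a) r n (r * n + 1 + j)| ≤
      Real.exp K * |q| ^ ((r * n + 1) * N) * (|q| ^ N) ^ j := by
    intro j
    obtain ⟨w, hw, he⟩ := hsize j
    rw [he]
    gcongr
    exact hw.abs_le_exp
  have hu0 : Real.exp (-K) * |q| ^ ((r * n + 1) * N) ≤ |rho q (2 * a) r n (r * n + 1 + 0)| := by
    obtain ⟨w, hw, he⟩ := hsize 0
    rw [he, pow_zero, mul_one]
    gcongr
    exact hw.exp_neg_le_abs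
  have hxN : |q| ^ N ≤ Real.exp (-(2 * K)) / 4 :=
    (pow_le_pow_of_le_one hq.le hq1.le hnN).trans hn
  have hmain := abs_log_abs_tsum_sub_log_le hK hP (by positivity) hxN hu hu0
  have hSt : St q (2 * a) r n = ∑' j, rho q (2 * a) r n (r * n + 1 + j) := by
    have hinj : Function.Injective fun j : ℕ => r * n + j := add_right_injective _
    rw [St, ← hinj.tsum_eq]
    · exact tsum_congr fun j => by rw [add_right_comm]
    · intro i hi
      by_contra hni
      refine hi (rho_eq_zero hq0 _ (by lia) ?_)
      by_contra hlt
      exact hni ⟨i - r * n, by simp only; lia⟩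
  rw [hSt]
  rw [Real.log_pow] at hmain
  convert hmain using 4
  push_cast
  rw [hNcast]

/-- `ρ_k(q) = 0` for `1 ≤ k ≤ rn` and
`lim (1/n²) log|S̃_n(q)| = −(r(A−2r)/2) log|1/q|`. -/
theorem stmt18 (A r : ℕ) (hA : Even A) (hA4 : 4 ≤ A) (hr : 1 ≤ r) (hAr : 2 * r < A)
    (q : ℝ) (hq0 : q ≠ 0) (hq1 : |q| < 1) :
    (∀ n k : ℕ, 1 ≤ k → k ≤ r * n → rho q A r n k = 0) ∧
    Filter.Tendsto (fun n : ℕ => (1 / (n : ℝ) ^ 2) * Real.log |St q A r n|)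
      Filter.atTop (nhds (-((r : ℝ) * ((A : ℝ) - 2 * r) / 2) * Real.log |1 / q|)) := by
  refine ⟨fun n k hk hkn => rho_eq_zero hq0 A hk hkn, ?_⟩
  obtain ⟨a, rfl⟩ := hA.two_dvd
  obtain ⟨C, hC⟩ := abs_log_abs_St_sub_le hq0 hq1 (a := a) (r := r) (by lia) (by lia)
  have hinv : Tendsto (fun n : ℕ => 1 / (n : ℝ)) atTop (nhds 0) :=
    tendsto_one_div_atTop_nhds_zero_nat
  have herr : Tendsto (fun n : ℕ => (1 / (n : ℝ) ^ 2) * (Real.log |St q (2 * a) r n| -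
      ((r * n + 1) * ((a - r) * n + a - 1) : ℝ) * Real.log |q|)) atTop (nhds 0) := by
    refine squeeze_zero_norm' (a := fun n : ℕ => (1 / (n : ℝ)) ^ 2 * C) ?_ ?_
    · filter_upwards [hC] with n hn
      rw [norm_mul, Real.norm_eq_abs, Real.norm_eq_abs, ← one_div_pow,
        abs_of_nonneg (by positivity : (0 : ℝ) ≤ (1 / (n : ℝ)) ^ 2)]
      gcongr
    · simpa using (hinv.pow 2).mul_const C
  have hlead : Tendsto (fun n : ℕ => ((r + 1 / (n : ℝ)) *
      ((a - r) + (a - 1) * (1 / (n : ℝ)))) * Real.log |q|) atTop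
      (nhds ((r + 0) * ((a - r) + (a - 1) * 0) * Real.log |q|)) :=
    ((hinv.const_add _).mul ((hinv.const_mul _).const_add _)).mul_const _
  have hsum := herr.add hlead
  have hlim : 0 + ((r : ℝ) + 0) * ((a - r) + (a - 1) * 0) * Real.log |q| =
      -((r : ℝ) * (((2 * a : ℕ) : ℝ) - 2 * r) / 2) * Real.log |1 / q| := by
    rw [one_div, abs_inv, Real.log_inv]
    push_cast
    ring
  rw [hlim] at hsum
  refine hsum.congr' ?_
  filter_upwards [eventually_gt_atTop 0] with n hn
  have hn0 : (n : ℝ) ≠ 0 := by positivity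
  field_simp
  ring
end
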